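/- arXiv:2209.06039 — 2 statements merged into one kernel-verified Lean document; each statement's English description precedes it below -/
import Mathlib

section
/- Let Γ be a directed graph (quiver) and S an inverse semigroup with a zero element 0 satisfying (P1) locally. Suppose e assigns to each vertex v a nonzero idempotent e_v ∈ S and t assigns to each edge x an element t_x ∈ S satisfying t_x*·t_x = e_{s(x)}, t_x·t_x* ≪ e_{r(x)}, and such that for distinct edges x ≠ x′ with r(x) = r(x′) one has t_x·t_x* ≠ t_{x′}·t_{x′}*. For each directed path α set s_α = t_{x₁}⋯t_{xₙ} (with s_α = e_v for the empty path at v) and e_α = s_α·s_α*. Then the map α ↦ e_α is injective on paths with a common range: for all paths μ, δ with r(μ) = r(δ), if e_μ = e_δ then μ = δ. -/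
/-- An inverse semigroup. -/
class InverseSemigroup (S : Type*) extends Semigroup S, Star S where
  mul_star_mul_self : ∀ s : S, s * star s * s = s
  star_mul_self_mul_star : ∀ s : S, star s * s * star s = star s
  star_unique : ∀ s a : S, s * a * s = s → a * s * a = a → a = star s

/-- Idempotent element. -/
def IsIdem {S : Type*} [Mul S] (e : S) : Prop := e * e = e

/-- The natural partial order: `s ≤ t` iff `s = t * e` for some idempotent `e`. -/
def NLe {S : Type*} [InverseSemigroup S] (s t : S) : Prop :=
  ∃ e : S, IsIdem e ∧ s = t * e

/-- Strict natural partial order. -/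
def NLt {S : Type*} [InverseSemigroup S] (s t : S) : Prop := NLe s t ∧ s ≠ t

/-- `e ≪ f`: `e < f` and there is no idempotent strictly between `e` and `f`. -/
def CovBelow {S : Type*} [InverseSemigroup S] (e f : S) : Prop :=
  NLt e f ∧ ¬ ∃ g : S, IsIdem g ∧ NLt e g ∧ NLt g f

/-- `sPath ev te α = te x₁ * ⋯ * te xₙ` for a path `α = x₁⋯xₙ` (range to source);
empty path at `v` gives `ev v`.  An arrow `x : a ⟶ b` has source `a`, range `b`;
a path `α : Quiver.Path a b` has source `a`, range `b`; for paths `α : Path m r`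
and `β : Path a m` (so `s(α) = r(β) = m`) the concatenation `αβ` is `β.comp α`. -/
def sPath {S : Type*} [InverseSemigroup S] {V : Type*} [Quiver V]
    (ev : V → S) (te : ∀ ⦃a b : V⦄, (a ⟶ b) → S) :
    ∀ {a b : V}, Quiver.Path a b → S
  | a, _, Quiver.Path.nil => ev a
  | _, _, Quiver.Path.cons p x => te x * sPath ev te p

namespace InverseSemigroup

variable {S : Type*} [InverseSemigroup S]

theorem star_eq_self {e : S} (he : IsIdem e) : star e = e := by
  have he' : e * e = e := he
  exact (star_unique e e (by rw [he', he']) (by rw [he', he'])).symm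

theorem isIdem_mul {e f : S} (he : IsIdem e) (hf : IsIdem f) : IsIdem (e * f) := by
  have he' : e * e = e := he
  have hf' : f * f = f := hf
  have hee : ∀ y, e * (e * y) = e * y := fun y => by rw [← mul_assoc, he']
  have hff : ∀ y, f * (f * y) = f * y := fun y => by rw [← mul_assoc, hf']
  have h1 := mul_star_mul_self (e * f)
  have h2 := star_mul_self_mul_star (e * f)
  generalize hx : star (e * f) = x at h1 h2
  have h3 : f * x * e = x := by
    rw [← hx]
    refine star_unique (e * f) _ ?_ ?_ <;> rw [hx]
    · simpa only [mul_assoc, hee, hff] using h1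
    · have : f * (x * (e * f) * x) * e = f * x * e := by rw [h2]
      simpa only [mul_assoc, hee, hff] using this
  have hxi : IsIdem x := by
    have : f * (x * (e * f) * x) * e = f * x * e := by rw [h2]
    calc x * x = (f * x * e) * (f * x * e) := by rw [h3]
      _ = f * (x * (e * f) * x) * e := by simp only [mul_assoc]
      _ = x := by rw [this, h3]
  have h4 : e * f = star x := star_unique x (e * f) h2 h1
  rw [h4, star_eq_self hxi]
  exact hxi

theorem idem_comm {e f : S} (he : IsIdem e) (hf : IsIdem f) : e * f = f * e := by
  have he' : e * e = e := he
  have hf' : f * f = f := hf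
  have hee : ∀ y, e * (e * y) = e * y := fun y => by rw [← mul_assoc, he']
  have hff : ∀ y, f * (f * y) = f * y := fun y => by rw [← mul_assoc, hf']
  have hef := isIdem_mul he hf
  have hfe := isIdem_mul hf he
  rw [← star_eq_self hef]
  refine (star_unique (e * f) (f * e) ?_ ?_).symm
  · simpa only [IsIdem, mul_assoc, hee, hff] using hef
  · simpa only [IsIdem, mul_assoc, hee, hff] using hfe

theorem isIdem_mul_star (s : S) : IsIdem (s * star s) := by
  rw [IsIdem, ← mul_assoc, mul_star_mul_self]

theorem isIdem_star_mul (s : S) : IsIdem (star s * s) := by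
  rw [IsIdem, ← mul_assoc, star_mul_self_mul_star]

theorem star_mul_rev (s t : S) : star (s * t) = star t * star s := by
  have hc := idem_comm (isIdem_star_mul s) (isIdem_mul_star t)
  refine (star_unique (s * t) _ ?_ ?_).symm
  · calc s * t * (star t * star s) * (s * t)
        = s * ((t * star t) * (star s * s)) * t := by simp only [mul_assoc]
      _ = (s * star s * s) * (t * star t * t) := by rw [← hc]; simp only [mul_assoc]
      _ = s * t := by rw [mul_star_mul_self, mul_star_mul_self]
  · calc star t * star s * (s * t) * (star t * star s)
        = star t * ((star s * s) * (t * star t)) * star s := by simp only [mul_assoc]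
      _ = (star t * t * star t) * (star s * s * star s) := by rw [hc]; simp only [mul_assoc]
      _ = star t * star s := by rw [star_mul_self_mul_star, star_mul_self_mul_star]

end InverseSemigroup

theorem NLe.mul_eq {S : Type*} [InverseSemigroup S] {e f : S} (hf : IsIdem f) (h : NLe e f) :
    f * e = e := by
  obtain ⟨g, -, rfl⟩ := h
  rw [← mul_assoc, hf]

theorem eq_of_covBelow_of_mul_ne_zero {S : Type*} [InverseSemigroup S] [Zero S]
    (hP1 : ∀ e f g : S, IsIdem e → IsIdem f → IsIdem g → NLe e g → NLe f g →
      ¬ NLe e f → ¬ NLe f e → e * f = 0)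
    {e f g : S} (he : IsIdem e) (hf : IsIdem f) (hg : IsIdem g)
    (heg : CovBelow e g) (hfg : CovBelow f g) (h0 : e * f ≠ 0) : e = f := by
  by_contra hne
  by_cases h : NLe e f
  · exact heg.2 ⟨f, hf, ⟨h, hne⟩, hfg.1⟩
  by_cases h' : NLe f e
  · exact hfg.2 ⟨e, he, ⟨h', Ne.symm hne⟩, heg.1⟩
  exact h0 (hP1 e f g he hf hg heg.1.1 hfg.1.1 h h')

section sPath

open InverseSemigroup

variable {S : Type*} [InverseSemigroup S] {V : Type*} [Quiver V]
  {ev : V → S} {te : ∀ ⦃a b : V⦄, (a ⟶ b) → S}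

theorem ev_mul_sPath (hev : ∀ v : V, IsIdem (ev v))
    (ht2 : ∀ ⦃a b : V⦄ (x : a ⟶ b), CovBelow (te x * star (te x)) (ev b))
    {a b : V} (p : Quiver.Path a b) : ev b * sPath ev te p = sPath ev te p := by
  cases p with
  | nil => rw [sPath, hev]
  | cons p x =>
    have h := (ht2 x).1.1.mul_eq (hev _)
    have h' : ev b * te x = te x := by
      calc ev b * te x = ev b * (te x * star (te x) * te x) := by rw [mul_star_mul_self]
        _ = ev b * (te x * star (te x)) * te x := by simp only [mul_assoc]
        _ = te x := by rw [h, mul_star_mul_self]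
    rw [sPath, ← mul_assoc, h']

theorem star_sPath_mul_sPath (hev : ∀ v : V, IsIdem (ev v))
    (ht1 : ∀ ⦃a b : V⦄ (x : a ⟶ b), star (te x) * te x = ev a)
    (ht2 : ∀ ⦃a b : V⦄ (x : a ⟶ b), CovBelow (te x * star (te x)) (ev b))
    {a b : V} (p : Quiver.Path a b) : star (sPath ev te p) * sPath ev te p = ev a := by
  induction p with
  | nil =>
    rw [sPath, star_eq_self (hev _)]
    exact hev _
  | cons p x ih =>
    rw [sPath, star_mul_rev, mul_assoc, ← mul_assoc (star (te x)), ht1,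
      ev_mul_sPath hev ht2, ih]

theorem sPath_mul_star_ne_zero [Zero S] (hz : ∀ s : S, 0 * s = 0 ∧ s * 0 = 0)
    (hev : ∀ v : V, IsIdem (ev v)) (hev0 : ∀ v : V, ev v ≠ 0)
    (ht1 : ∀ ⦃a b : V⦄ (x : a ⟶ b), star (te x) * te x = ev a)
    (ht2 : ∀ ⦃a b : V⦄ (x : a ⟶ b), CovBelow (te x * star (te x)) (ev b))
    {a b : V} (p : Quiver.Path a b) : sPath ev te p * star (sPath ev te p) ≠ 0 := by
  intro h
  have hs : sPath ev te p = 0 := by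
    rw [← mul_star_mul_self (sPath ev te p), h, (hz _).1]
  apply hev0 a
  rw [← star_sPath_mul_sPath hev ht1 ht2 p, hs, (hz _).2]

theorem mul_star_mul_sPath_cons {a b c : V} (p : Quiver.Path a b) (x : b ⟶ c) :
    te x * star (te x) * (sPath ev te (p.cons x) * star (sPath ev te (p.cons x))) =
      sPath ev te (p.cons x) * star (sPath ev te (p.cons x)) := by
  rw [← mul_assoc]
  congr 1
  rw [sPath, ← mul_assoc, mul_star_mul_self]

theorem conj_sPath_cons (hev : ∀ v : V, IsIdem (ev v))
    (ht1 : ∀ ⦃a b : V⦄ (x : a ⟶ b), star (te x) * te x = ev a)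
    (ht2 : ∀ ⦃a b : V⦄ (x : a ⟶ b), CovBelow (te x * star (te x)) (ev b))
    {a b c : V} (p : Quiver.Path a b) (x : b ⟶ c) :
    star (te x) * (sPath ev te (p.cons x) * star (sPath ev te (p.cons x))) * te x =
      sPath ev te p * star (sPath ev te p) := by
  have h := ev_mul_sPath hev ht2 p
  have h' : star (sPath ev te p) * ev b = star (sPath ev te p) := by
    rw [← star_eq_self (hev b), ← star_mul_rev, h]
  calc _ = (star (te x) * te x) * sPath ev te p *
        (star (sPath ev te p) * (star (te x) * te x)) := by
        rw [sPath, star_mul_rev]; simp only [mul_assoc]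
    _ = _ := by rw [ht1, h, h']

theorem ev_ne_sPath_cons_mul_star (hev : ∀ v : V, IsIdem (ev v))
    (ht2 : ∀ ⦃a b : V⦄ (x : a ⟶ b), CovBelow (te x * star (te x)) (ev b))
    {a b c : V} (p : Quiver.Path a b) (x : b ⟶ c) :
    ev c ≠ sPath ev te (p.cons x) * star (sPath ev te (p.cons x)) := by
  intro h
  have h1 := mul_star_mul_sPath_cons (ev := ev) (te := te) p x
  rw [← h, idem_comm (isIdem_mul_star _) (hev c), (ht2 x).1.1.mul_eq (hev c)] at h1
  exact (ht2 x).1.2 h1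

end sPath

/-- under the same hypotheses as Statement 3, the map
`α ↦ e_α = s_α * star (s_α)` is injective on paths with a common range. -/
theorem stmt4 {S : Type*} [InverseSemigroup S] [Zero S] {V : Type*} [Quiver V]
    (hz : ∀ s : S, 0 * s = 0 ∧ s * 0 = 0)
    (hP1 : ∀ e f g : S, IsIdem e → IsIdem f → IsIdem g → NLe e g → NLe f g →
      ¬ NLe e f → ¬ NLe f e → e * f = 0)
    (ev : V → S) (te : ∀ ⦃a b : V⦄, (a ⟶ b) → S)
    (hev : ∀ v : V, IsIdem (ev v)) (hev0 : ∀ v : V, ev v ≠ 0)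
    (ht1 : ∀ ⦃a b : V⦄ (x : a ⟶ b), star (te x) * te x = ev a)
    (ht2 : ∀ ⦃a b : V⦄ (x : a ⟶ b), CovBelow (te x * star (te x)) (ev b))
    (hinj : ∀ (v u u' : V) (x : u ⟶ v) (x' : u' ⟶ v),
      (⟨u, x⟩ : Σ w : V, w ⟶ v) ≠ ⟨u', x'⟩ →
      te x * star (te x) ≠ te x' * star (te x')) :
    ∀ {a b c : V} (μ : Quiver.Path a c) (δ : Quiver.Path b c),
      sPath ev te μ * star (sPath ev te μ) = sPath ev te δ * star (sPath ev te δ) →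
      a = b ∧ HEq μ δ := by
  intro a b c μ
  induction μ with
  | nil =>
    intro δ h
    cases δ with
    | nil => exact ⟨rfl, HEq.rfl⟩
    | cons p x =>
      rw [sPath, InverseSemigroup.star_eq_self (hev _), hev] at h
      exact absurd h (ev_ne_sPath_cons_mul_star hev ht2 p x)
  | @cons m c p x ih =>
    intro δ h
    cases δ with
    | nil =>
      rw [sPath.eq_1, InverseSemigroup.star_eq_self (hev _), hev] at h
      exact absurd h.symm (ev_ne_sPath_cons_mul_star hev ht2 p x)
    | @cons m' _ q y =>
      have hxy : te x * star (te x) = te y * star (te y) := by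
        refine eq_of_covBelow_of_mul_ne_zero hP1 (InverseSemigroup.isIdem_mul_star _)
          (InverseSemigroup.isIdem_mul_star _) (hev c) (ht2 x) (ht2 y) fun h0 => ?_
        apply sPath_mul_star_ne_zero hz hev hev0 ht1 ht2 (p.cons x)
        rw [← mul_star_mul_sPath_cons p x, h, ← mul_star_mul_sPath_cons q y, ← mul_assoc,
          h0, (hz _).1]
      have hsig : (⟨m, x⟩ : Σ w : V, w ⟶ c) = ⟨m', y⟩ := by
        by_contra hne
        exact hinj c m m' x y hne hxy
      cases hsig
      have hpq := conj_sPath_cons hev ht1 ht2 p x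
      rw [h, conj_sPath_cons hev ht1 ht2 q x] at hpq
      obtain ⟨rfl, hh⟩ := ih q hpq.symm
      cases hh
      exact ⟨rfl, HEq.rfl⟩
end

section
/- Let S be an inverse semigroup, let e, f be idempotents, and let s, t ∈ S with s·s* ≤ e, s*·s ≤ f, t·t* ≤ f, t*·t ≤ e, s·t = e, and t·s = f. Then t = s*, s·s* = e, and s*·s = f. Consequently, two idempotents e and f are isomorphic as objects of the idempotent splitting C(S) if and only if e D f, i.e., there exists x ∈ S with x*·x = e and x·x* = f. -/
namespace InverseSemigroup

variable {S : Type*} [InverseSemigroup S]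

theorem star_star_eq (s : S) : star (star s) = s :=
  (star_unique (star s) s (star_mul_self_mul_star s) (mul_star_mul_self s)).symm

theorem mul_eq_self_of_nle {e s : S} (he : IsIdem e) (h : NLe (s * star s) e) : e * s = s := by
  obtain ⟨g, -, hg⟩ := h
  have he' : e * e = e := he
  calc e * s = e * (s * star s * s) := by rw [mul_star_mul_self]
    _ = e * e * g * s := by rw [hg]; simp only [mul_assoc]
    _ = s := by rw [he', ← hg, mul_star_mul_self]

theorem eq_star_of_mul_eq {e f s t : S} (he : IsIdem e) (hf : IsIdem f)
    (hs : NLe (s * star s) e) (ht : NLe (t * star t) f) (hst : s * t = e) (hts : t * s = f) :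
    t = star s :=
  star_unique s t (by rw [hst, mul_eq_self_of_nle he hs]) (by rw [hts, mul_eq_self_of_nle hf ht])

end InverseSemigroup

theorem NLe.of_isIdem {S : Type*} [InverseSemigroup S] {e : S} (he : IsIdem e) : NLe e e :=
  ⟨e, he, he.symm⟩

/-- STATEMENT 14: if `s : e → f` and `t : f → e` are mutually inverse morphisms in
the idempotent splitting `C(S)` (so `s * star s ≤ e`, `star s * s ≤ f`,
`t * star t ≤ f`, `star t * t ≤ e`, `s * t = e`, `t * s = f`), then `t = star s`,
`s * star s = e` and `star s * s = f`.  Consequently, idempotents `e` and `f`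
are isomorphic in `C(S)` if and only if `e D f`. -/
theorem stmt14 {S : Type*} [InverseSemigroup S] :
    (∀ e f s t : S, IsIdem e → IsIdem f →
      NLe (s * star s) e → NLe (star s * s) f →
      NLe (t * star t) f → NLe (star t * t) e →
      s * t = e → t * s = f →
      t = star s ∧ s * star s = e ∧ star s * s = f) ∧
    (∀ e f : S, IsIdem e → IsIdem f →
      ((∃ s t : S, NLe (s * star s) e ∧ NLe (star s * s) f ∧
          NLe (t * star t) f ∧ NLe (star t * t) e ∧ s * t = e ∧ t * s = f) ↔
        (∃ x : S, star x * x = e ∧ x * star x = f))) := by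
  have key : ∀ e f s t : S, IsIdem e → IsIdem f →
      NLe (s * star s) e → NLe (t * star t) f → s * t = e → t * s = f →
      t = star s ∧ s * star s = e ∧ star s * s = f := by
    intro e f s t he hf hs ht hst hts
    have h := InverseSemigroup.eq_star_of_mul_eq he hf hs ht hst hts
    exact ⟨h, h ▸ hst, h ▸ hts⟩
  refine ⟨fun e f s t he hf hs _ ht _ => key e f s t he hf hs ht, fun e f he hf => ⟨?_, ?_⟩⟩
  · rintro ⟨s, t, hs, -, ht, -, hst, hts⟩
    obtain ⟨-, hse, hsf⟩ := key e f s t he hf hs ht hst hts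
    exact ⟨star s, by rwa [InverseSemigroup.star_star_eq],
      by rwa [InverseSemigroup.star_star_eq]⟩
  · rintro ⟨x, hxe, hxf⟩
    refine ⟨star x, x, ?_, ?_, ?_, ?_, hxe, hxf⟩ <;>
      simp only [InverseSemigroup.star_star_eq, hxe, hxf] <;>
      first | exact NLe.of_isIdem he | exact NLe.of_isIdem hf
end
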